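/- Let (V, F, G) be a finite-dimensional vector space with two exhaustive decreasing filtrations, and let RR(V,F,G) = ∑_{p,q} u^{−p} v^{−q} (F^p ∩ G^q) ⊆ V ⊗_k k[u,u^{−1},v,v^{−1}] be the double Rees module over k[u,v]. Then RR(V,F,G)/(u,v) ≅ ⊕_{p,q} Gr_F^p Gr_G^q V and RR(V,F,G)/(u−1, v−1) ≅ V. -/

import Mathlib

open Submodule DirectSum

noncomputable section

variable {k V : Type*} [Field k] [AddCommGroup V] [Module k V]

/-! We model `V ⊗_k k[u,u⁻¹,v,v⁻¹]` by the canonically isomorphic space `(ℤ × ℤ) →₀ V`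
(`u^i v^j ⊗ w ↦ Finsupp.single (i, j) w`); multiplication by `u` (resp. `v`) becomes
the exponent shift by `(1,0)` (resp. `(0,1)`). -/

/-- The double Rees module `RR(V,F,G) = ∑_{p,q} u^{-p} v^{-q} (F^p ∩ G^q)`, the
`k[u,v]`-submodule of `V ⊗_k k[u,u⁻¹,v,v⁻¹]` generated by the `u^{-p}v^{-q}·w`,
`w ∈ F^p ∩ G^q`. -/
def ReesModule2 (F G : ℤ → Submodule k V) : Submodule k ((ℤ × ℤ) →₀ V) :=
  ⨆ pq : ℤ × ℤ, Submodule.map (Finsupp.lsingle (-pq.1, -pq.2)) (F pq.1 ⊓ G pq.2)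

/-- Multiplication by `u`. -/
def mulU2 : ((ℤ × ℤ) →₀ V) →ₗ[k] ((ℤ × ℤ) →₀ V) :=
  Finsupp.lmapDomain V k (fun g => g + (1, 0))

/-- Multiplication by `v`. -/
def mulV2 : ((ℤ × ℤ) →₀ V) →ₗ[k] ((ℤ × ℤ) →₀ V) :=
  Finsupp.lmapDomain V k (fun g => g + (0, 1))

theorem rr_mem_S (H : ℤ × ℤ → Submodule k V) (f : (ℤ × ℤ) →₀ V) :
    f ∈ (⨆ pq : ℤ × ℤ, Submodule.map (Finsupp.lsingle (R := k) (-pq.1, -pq.2)) (H pq)) ↔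
      ∀ pq : ℤ × ℤ, f (-pq.1, -pq.2) ∈ H pq := by
  constructor
  · intro h pq
    have : (⨆ pq : ℤ × ℤ, Submodule.map (Finsupp.lsingle (R := k) (-pq.1, -pq.2)) (H pq)) ≤
        (H pq).comap (Finsupp.lapply (-pq.1, -pq.2)) := by
      refine iSup_le ?_
      rintro ⟨a, b⟩
      rw [Submodule.map_le_iff_le_comap]
      intro x hx
      obtain ⟨p, q⟩ := pq
      simp only [Submodule.mem_comap, Finsupp.lapply_apply, Finsupp.lsingle_apply,
        Finsupp.single_apply]
      split_ifs with h
      · simp only [Prod.mk.injEq, neg_inj] at h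
        obtain ⟨rfl, rfl⟩ := h
        exact hx
      · exact Submodule.zero_mem _
    exact this h
  · intro h
    rw [← Finsupp.sum_single f]
    refine Submodule.sum_mem _ fun i _ => ?_
    refine Submodule.mem_iSup_of_mem (-i.1, -i.2) ?_
    refine ⟨f i, ?_, ?_⟩
    · simpa using h (-i.1, -i.2)
    · simp

theorem rr_mapU (F G : ℤ → Submodule k V) :
    Submodule.map (mulU2 (k := k) (V := V)) (ReesModule2 F G) =
      ⨆ pq : ℤ × ℤ, Submodule.map (Finsupp.lsingle (R := k) (-pq.1, -pq.2))
        (F (pq.1 + 1) ⊓ G pq.2) := by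
  rw [ReesModule2, Submodule.map_iSup]
  refine (Equiv.iSup_congr ((Equiv.addRight ((1, 0) : ℤ × ℤ))) ?_).symm
  rintro ⟨p, q⟩
  rw [← Submodule.map_comp]
  simp only [Equiv.coe_addRight, Prod.mk_add_mk, add_zero]
  congr 1
  ext x : 1
  simp [mulU2, Finsupp.mapDomain_single]

theorem rr_mapV (F G : ℤ → Submodule k V) :
    Submodule.map (mulV2 (k := k) (V := V)) (ReesModule2 F G) =
      ⨆ pq : ℤ × ℤ, Submodule.map (Finsupp.lsingle (R := k) (-pq.1, -pq.2))
        (F pq.1 ⊓ G (pq.2 + 1)) := by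
  rw [ReesModule2, Submodule.map_iSup]
  refine (Equiv.iSup_congr ((Equiv.addRight ((0, 1) : ℤ × ℤ))) ?_).symm
  rintro ⟨p, q⟩
  rw [← Submodule.map_comp]
  simp only [Equiv.coe_addRight, Prod.mk_add_mk, add_zero]
  congr 1
  ext x : 1
  simp [mulV2, Finsupp.mapDomain_single]

theorem rr_mem_N (F G : ℤ → Submodule k V) (f : (ℤ × ℤ) →₀ V) :
    f ∈ Submodule.map (mulU2 (k := k) (V := V)) (ReesModule2 F G) ⊔
                Submodule.map (mulV2 (k := k) (V := V)) (ReesModule2 F G) ↔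
      ∀ pq : ℤ × ℤ, f (-pq.1, -pq.2) ∈
        (F (pq.1 + 1) ⊓ G pq.2) ⊔ (F pq.1 ⊓ G (pq.2 + 1)) := by
  rw [rr_mapU, rr_mapV, ← iSup_sup_eq]
  simp_rw [← Submodule.map_sup]
  exact rr_mem_S (fun pq => (F (pq.1 + 1) ⊓ G pq.2) ⊔ (F pq.1 ⊓ G (pq.2 + 1))) f

/-- The map from the external direct sum of the pieces. -/
def rrAlpha (F G : ℤ → Submodule k V) :
    (⨁ pq : ℤ × ℤ, ↥(F pq.1 ⊓ G pq.2)) →ₗ[k] ((ℤ × ℤ) →₀ V) :=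
  DirectSum.toModule k _ _ fun pq =>
    (Finsupp.lsingle (-pq.1, -pq.2)).comp (F pq.1 ⊓ G pq.2).subtype

theorem rrAlpha_apply (F G : ℤ → Submodule k V)
    (e : ⨁ pq : ℤ × ℤ, ↥(F pq.1 ⊓ G pq.2)) (pq : ℤ × ℤ) :
    rrAlpha F G e (-pq.1, -pq.2) = (e pq : V) := by
  induction e using DirectSum.induction_on with
  | zero => simp
  | of i x =>
    change rrAlpha F G (DirectSum.lof k _ _ i x) _ = ((DirectSum.lof k _ _ i x : ⨁ pq : ℤ × ℤ, ↥(F pq.1 ⊓ G pq.2)) pq : V)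
    rw [rrAlpha, DirectSum.toModule_lof]
    by_cases h : i = pq
    · subst h
      rw [DirectSum.lof_apply]
      simp
    · have h2 : ¬ ((-i.1, -i.2) = (-pq.1, -pq.2)) := by
        intro h3
        simp only [Prod.mk.injEq, neg_inj] at h3
        exact h (Prod.ext h3.1 h3.2)
      rw [DirectSum.lof_eq_of, DirectSum.of_eq_of_ne _ _ _ (Ne.symm h)]
      simp [Finsupp.single_apply]
      intro h4 h5
      exact absurd (Prod.ext h4 h5) h
  | add x y hx hy => simp [hx, hy]

theorem rrAlpha_injective (F G : ℤ → Submodule k V) : Function.Injective (rrAlpha F G) := by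
  intro x y h
  refine DFinsupp.ext fun pq => Subtype.ext ?_
  have := rrAlpha_apply F G x pq
  rw [h, rrAlpha_apply] at this
  exact this.symm

theorem rrAlpha_range (F G : ℤ → Submodule k V) :
    LinearMap.range (rrAlpha F G) = ReesModule2 F G := by
  apply le_antisymm
  · rintro _ ⟨e, rfl⟩
    refine (rr_mem_S (fun pq => F pq.1 ⊓ G pq.2) _).2 fun pq => ?_
    rw [rrAlpha_apply]
    exact (e pq).2
  · refine iSup_le fun pq => ?_
    rintro _ ⟨x, hx, rfl⟩
    refine ⟨DirectSum.lof k _ (fun pq : ℤ × ℤ => ↥(F pq.1 ⊓ G pq.2)) pq ⟨x, hx⟩, ?_⟩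
    rw [rrAlpha, DirectSum.toModule_lof]
    rfl

/-- The projection to the direct sum of the bigraded pieces. -/
def rrBeta (F G : ℤ → Submodule k V) :
    (⨁ pq : ℤ × ℤ, ↥(F pq.1 ⊓ G pq.2)) →ₗ[k] (⨁ pq : ℤ × ℤ,
            ↥(F pq.1 ⊓ G pq.2) ⧸
              Submodule.comap (F pq.1 ⊓ G pq.2).subtype
                ((F (pq.1 + 1) ⊓ G pq.2) ⊔ (F pq.1 ⊓ G (pq.2 + 1)))) :=
  DFinsupp.mapRange.linearMap fun pq => Submodule.mkQ _

theorem rrBeta_surjective (F G : ℤ → Submodule k V) : Function.Surjective (rrBeta F G) :=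
  (DFinsupp.mapRange_surjective _ (fun _ => map_zero _)).2 fun _ => Submodule.mkQ_surjective _

theorem rrBeta_ker (F G : ℤ → Submodule k V) (e : ⨁ pq : ℤ × ℤ, ↥(F pq.1 ⊓ G pq.2)) :
    rrBeta F G e = 0 ↔ rrAlpha F G e ∈ (Submodule.map (mulU2 (k := k) (V := V)) (ReesModule2 F G) ⊔
                Submodule.map (mulV2 (k := k) (V := V)) (ReesModule2 F G)) := by
  rw [rr_mem_N, DFinsupp.ext_iff]
  refine forall_congr' fun pq => ?_
  rw [rrAlpha_apply]
  change Submodule.Quotient.mk (e pq) = 0 ↔ _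
  rw [Submodule.Quotient.mk_eq_zero]
  rfl

theorem rr_abstract {E W Q : Type*} [AddCommMonoid E] [Module k E] [AddCommGroup W] [Module k W]
    [AddCommMonoid Q] [Module k Q] (α : E →ₗ[k] W) (β : E →ₗ[k] Q) (R N : Submodule k W)
    (hα : Function.Injective α) (hR : LinearMap.range α = R) (hβ : Function.Surjective β)
    (h : ∀ e, β e = 0 ↔ α e ∈ N) :
    Nonempty ((↥R ⧸ Submodule.comap R.subtype N) ≃ₗ[k] Q) := by
  subst hR
  letI : AddCommGroup E := Module.addCommMonoidToAddCommGroup k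
  letI : AddCommGroup Q := Module.addCommMonoidToAddCommGroup k
  refine ⟨(Submodule.Quotient.equiv (LinearMap.ker β) _
    (LinearEquiv.ofInjective α hα) ?_).symm.trans (β.quotKerEquivOfSurjective hβ)⟩
  have key : LinearMap.ker β = Submodule.comap
      (LinearEquiv.ofInjective α hα : E →ₗ[k] LinearMap.range α)
      (Submodule.comap (LinearMap.range α).subtype N) := by
    ext e
    exact h e
  rw [key]
  exact Submodule.map_comap_eq_of_surjective (LinearEquiv.ofInjective α hα).surjective _

theorem rr_part1 (F G : ℤ → Submodule k V) :
    Nonempty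
        ((↥(ReesModule2 F G) ⧸
            Submodule.comap (ReesModule2 F G).subtype
              (Submodule.map (mulU2 (k := k) (V := V)) (ReesModule2 F G) ⊔
                Submodule.map (mulV2 (k := k) (V := V)) (ReesModule2 F G)))
          ≃ₗ[k]
          (⨁ pq : ℤ × ℤ,
            ↥(F pq.1 ⊓ G pq.2) ⧸
              Submodule.comap (F pq.1 ⊓ G pq.2).subtype
                ((F (pq.1 + 1) ⊓ G pq.2) ⊔ (F pq.1 ⊓ G (pq.2 + 1))))) :=
  rr_abstract (rrAlpha F G) (rrBeta F G) _ _ (rrAlpha_injective F G) (rrAlpha_range F G)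
    (rrBeta_surjective F G) (rrBeta_ker F G)

theorem rr_single_mem (F G : ℤ → Submodule k V) (p q : ℤ) {x : V} (hx : x ∈ F p ⊓ G q) :
    Finsupp.single (-p, -q) x ∈ ReesModule2 F G :=
  Submodule.mem_iSup_of_mem (p, q) ⟨x, hx, rfl⟩

theorem rr_shift (F G : ℤ → Submodule k V)
    (hF : ∀ p q : ℤ, p ≤ q → F q ≤ F p) (hG : ∀ p q : ℤ, p ≤ q → G q ≤ G p)
    (p q : ℤ) {x : V} (hx : x ∈ F p ⊓ G q) (n m : ℕ) :
    Finsupp.single (-(p - n), -(q - m)) x - Finsupp.single (-p, -q) x ∈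
      (Submodule.map (mulU2 (k := k) (V := V) - LinearMap.id) (ReesModule2 F G) ⊔
                Submodule.map (mulV2 (k := k) (V := V) - LinearMap.id) (ReesModule2 F G)) := by
  have h1 : ∀ n : ℕ, Finsupp.single (-(p - n), -q) x - Finsupp.single (-p, -q) x ∈
      (Submodule.map (mulU2 (k := k) (V := V) - LinearMap.id) (ReesModule2 F G) ⊔
                Submodule.map (mulV2 (k := k) (V := V) - LinearMap.id) (ReesModule2 F G)) := by
    intro n
    induction n with
    | zero => simp
    | succ n ih =>
      rw [← sub_add_sub_cancel _ (Finsupp.single (-(p - n), -q) x)]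
      refine Submodule.add_mem _ (Submodule.mem_sup_left
        ⟨_, rr_single_mem F G (p - n) q ⟨hF _ _ (by lia) hx.1, hx.2⟩, ?_⟩) ih
      simp only [mulU2, LinearMap.sub_apply, Finsupp.lmapDomain_apply, Finsupp.mapDomain_single,
        LinearMap.id_apply, Prod.mk_add_mk, add_zero]
      congr 3
      push_cast
      ring
  have h2 : Finsupp.single (-(p - n), -(q - m)) x - Finsupp.single (-(p - n), -q) x ∈
      (Submodule.map (mulU2 (k := k) (V := V) - LinearMap.id) (ReesModule2 F G) ⊔
                Submodule.map (mulV2 (k := k) (V := V) - LinearMap.id) (ReesModule2 F G)) := by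
    induction m with
    | zero => simp
    | succ m ih =>
      rw [← sub_add_sub_cancel _ (Finsupp.single (-(p - n), -(q - m)) x)]
      refine Submodule.add_mem _ (Submodule.mem_sup_right
        ⟨_, rr_single_mem F G (p - n) (q - m)
          ⟨hF _ _ (by lia) hx.1, hG _ _ (by lia) hx.2⟩, ?_⟩) ih
      simp only [mulV2, LinearMap.sub_apply, Finsupp.lmapDomain_apply, Finsupp.mapDomain_single,
        LinearMap.id_apply, Prod.mk_add_mk, add_zero]
      congr 3
      push_cast
      ring
  rw [← sub_add_sub_cancel _ (Finsupp.single (-(p - n), -q) x)]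
  exact Submodule.add_mem _ h2 (h1 n)

theorem rr_part2 (F G : ℤ → Submodule k V)
    (hF : ∀ p q : ℤ, p ≤ q → F q ≤ F p) (hG : ∀ p q : ℤ, p ≤ q → G q ≤ G p)
    (hFtop : ∃ a : ℤ, F a = ⊤) (hGtop : ∃ a : ℤ, G a = ⊤) :
      Nonempty
        ((↥(ReesModule2 F G) ⧸
            Submodule.comap (ReesModule2 F G).subtype
              (Submodule.map (mulU2 (k := k) (V := V) - LinearMap.id) (ReesModule2 F G) ⊔
                Submodule.map (mulV2 (k := k) (V := V) - LinearMap.id) (ReesModule2 F G)))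
          ≃ₗ[k] V) := by
  obtain ⟨a, ha⟩ := hFtop
  obtain ⟨b, hb⟩ := hGtop
  let σ : ((ℤ × ℤ) →₀ V) →ₗ[k] V := Finsupp.lsum k fun _ => LinearMap.id
  have hσ : ∀ i x, σ (Finsupp.single i x) = x := fun i x => by simp [σ]
  have htop : ∀ x : V, x ∈ F a ⊓ G b := fun x => by simp [ha, hb]
  have hs : Function.Surjective (σ.comp (ReesModule2 F G).subtype) := fun x =>
    ⟨⟨_, rr_single_mem F G a b (htop x)⟩, hσ _ x⟩
  have hU : σ.comp (mulU2 (k := k) (V := V) - LinearMap.id) = 0 := by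
    ext i x
    simp [mulU2, Finsupp.mapDomain_single, hσ]
  have hV : σ.comp (mulV2 (k := k) (V := V) - LinearMap.id) = 0 := by
    ext i x
    simp [mulV2, Finsupp.mapDomain_single, hσ]
  have hR : ReesModule2 F G ≤ Submodule.comap
      (LinearMap.id - (Finsupp.lsingle (-a, -b)).comp σ)
      (Submodule.map (mulU2 (k := k) (V := V) - LinearMap.id) (ReesModule2 F G) ⊔
                Submodule.map (mulV2 (k := k) (V := V) - LinearMap.id) (ReesModule2 F G)) := by
    refine iSup_le ?_
    rintro ⟨p, q⟩
    rintro _ ⟨x, hx, rfl⟩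
    simp only [Submodule.mem_comap, LinearMap.sub_apply, LinearMap.id_apply, LinearMap.comp_apply,
      Finsupp.lsingle_apply, hσ]
    have e1 := rr_shift F G hF hG p q hx (p - a).toNat (q - b).toNat
    have e2 := rr_shift F G hF hG a b (htop x) (a - p).toNat (b - q).toNat
    have i1 : a - ((a - p).toNat : ℤ) = p - ((p - a).toNat : ℤ) := by lia
    have i2 : b - ((b - q).toNat : ℤ) = q - ((q - b).toNat : ℤ) := by lia
    rw [i1, i2] at e2
    have := Submodule.sub_mem _ e2 e1
    rwa [sub_sub_sub_cancel_left] at this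
  refine ⟨(Submodule.quotEquivOfEq _ _ ?_).trans
    ((σ.comp (ReesModule2 F G).subtype).quotKerEquivOfSurjective hs)⟩
  rw [LinearMap.ker_comp]
  apply le_antisymm
  · refine Submodule.comap_mono (sup_le ?_ ?_)
    · rintro _ ⟨y, -, rfl⟩
      exact LinearMap.congr_fun hU y
    · rintro _ ⟨y, -, rfl⟩
      exact LinearMap.congr_fun hV y
  · rintro ⟨f, hf⟩ h
    have h0 : σ f = 0 := h
    have := hR hf
    rw [Submodule.mem_comap, LinearMap.sub_apply, LinearMap.comp_apply, h0, map_zero, sub_zero] at this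
    exact this

/-- `RR(V,F,G)/(u,v) ≅ ⊕_{p,q} Gr_F^p Gr_G^q V` and `RR(V,F,G)/(u-1,v-1) ≅ V`,
where `Gr_F^p Gr_G^q V` is realized via the canonical (Zassenhaus) isomorphism as
`(F^p ⊓ G^q)/((F^{p+1} ⊓ G^q) ⊔ (F^p ⊓ G^{q+1}))`. -/
theorem double_rees_module_fibres
    [FiniteDimensional k V] (F G : ℤ → Submodule k V)
    (hF : ∀ p q : ℤ, p ≤ q → F q ≤ F p) (hG : ∀ p q : ℤ, p ≤ q → G q ≤ G p)
    (hFtop : ∃ a : ℤ, F a = ⊤) (hFbot : ∃ b : ℤ, F b = ⊥)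
    (hGtop : ∃ a : ℤ, G a = ⊤) (hGbot : ∃ b : ℤ, G b = ⊥) :
    Nonempty
        ((↥(ReesModule2 F G) ⧸
            Submodule.comap (ReesModule2 F G).subtype
              (Submodule.map (mulU2 (k := k) (V := V)) (ReesModule2 F G) ⊔
                Submodule.map (mulV2 (k := k) (V := V)) (ReesModule2 F G)))
          ≃ₗ[k]
          ⨁ pq : ℤ × ℤ,
            ↥(F pq.1 ⊓ G pq.2) ⧸
              Submodule.comap (F pq.1 ⊓ G pq.2).subtype
                ((F (pq.1 + 1) ⊓ G pq.2) ⊔ (F pq.1 ⊓ G (pq.2 + 1)))) ∧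
      Nonempty
        ((↥(ReesModule2 F G) ⧸
            Submodule.comap (ReesModule2 F G).subtype
              (Submodule.map (mulU2 (k := k) (V := V) - LinearMap.id) (ReesModule2 F G) ⊔
                Submodule.map (mulV2 (k := k) (V := V) - LinearMap.id) (ReesModule2 F G)))
          ≃ₗ[k] V) := by
  exact ⟨rr_part1 F G, rr_part2 F G hF hG hFtop hGtop⟩

end
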